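/- Let d ≥ 1, p₁ ∈ ℕ and Q ⊆ ℤ^d. Assume Q is even-nondegenerate of degree p₁ and odd-nondegenerate of degree p₁. Let (a_α) and (a'_α) be two families of real numbers indexed by multi-indices α ∈ ℕ^d with |α| ≤ p₁, and suppose there exists δ > 0 such that exp( ∑_{|α| ≤ p₁} a_α (iξ)^α · t ) = exp( ∑_{|α| ≤ p₁} a'_α (iξ)^α · t ) (an equality of complex numbers, exp being the complex exponential) for every ξ ∈ Q and every t ∈ (0, δ). Then a_α = a'_α for every multi-index α with |α| ≤ p₁. -/

import Mathlib

open Finset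

/-- The finite set of multi-indices `α ∈ ℕ^d` with `|α| = ∑ m, α m ≤ p`. -/
def multiIdx (d p : ℕ) : Finset (Fin d → ℕ) :=
  (Fintype.piFinset fun _ : Fin d => Finset.range (p + 1)).filter fun α => (∑ m, α m) ≤ p

/-- Complex numbers `z`, `w` for which `exp (z t) = exp (w t)` for all small `t > 0` are equal. -/
theorem Complex.eq_of_exp_mul_eq_on_Ioo {z w : ℂ} {δ : ℝ} (hδ : 0 < δ)
    (h : ∀ t ∈ Set.Ioo (0 : ℝ) δ, Complex.exp (z * t) = Complex.exp (w * t)) : z = w := by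
  have hderiv (c : ℂ) : HasDerivAt (fun t : ℝ => Complex.exp (c * t))
      (Complex.exp (c * (δ / 2 : ℝ)) * c) (δ / 2) := by
    simpa using ((Complex.ofRealCLM.hasDerivAt (x := δ / 2)).const_mul c).cexp
  have hmem : δ / 2 ∈ Set.Ioo (0 : ℝ) δ := ⟨by linarith, by linarith⟩
  have heq : (fun t : ℝ => Complex.exp (z * t)) =ᶠ[nhds (δ / 2)]
      fun t : ℝ => Complex.exp (w * t) := by
    filter_upwards [isOpen_Ioo.mem_nhds hmem] with t ht using h t ht
  have key := (hderiv z).unique ((hderiv w).congr_of_eventuallyEq heq)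
  rw [h _ hmem] at key
  exact mul_left_cancel₀ (Complex.exp_ne_zero _) key

theorem Complex.I_pow_re (n : ℕ) :
    (Complex.I ^ n).re = if Even n then (-1 : ℝ) ^ (n / 2) else 0 := by
  rcases Nat.even_or_odd' n with ⟨k, rfl | rfl⟩
  · have : (Complex.I ^ (2 * k)) = (((-1 : ℝ) ^ k : ℝ) : ℂ) := by simp [pow_mul]
    rw [this, Complex.ofReal_re]
    simp
  · have : (Complex.I ^ (2 * k + 1)) = (((-1 : ℝ) ^ k : ℝ) : ℂ) * Complex.I := by
      simp [pow_succ, pow_mul]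
    rw [this, Complex.re_ofReal_mul]
    simp

theorem Complex.I_pow_im (n : ℕ) :
    (Complex.I ^ n).im = if Odd n then (-1 : ℝ) ^ (n / 2) else 0 := by
  rcases Nat.even_or_odd' n with ⟨k, rfl | rfl⟩
  · have : (Complex.I ^ (2 * k)) = (((-1 : ℝ) ^ k : ℝ) : ℂ) := by simp [pow_mul]
    rw [this, Complex.ofReal_im]
    simp
  · have : (Complex.I ^ (2 * k + 1)) = (((-1 : ℝ) ^ k : ℝ) : ℂ) * Complex.I := by
      simp [pow_succ, pow_mul]
    have hk : (2 * k + 1) / 2 = k := by omega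
    rw [this, Complex.im_ofReal_mul, hk]
    simp

/-- **Deterministic core of Proposition 3.1 (additive noise).** If `Q ⊆ ℤ^d` is
even-nondegenerate and odd-nondegenerate of degree `p₁`, and the exponentials
`exp(∑_{|α| ≤ p₁} a_α (iξ)^α t)` agree on `Q` for all small `t > 0`, then the
coefficients agree. -/
theorem stmt7
    (d p₁ : ℕ) (hd : 1 ≤ d) (Q : Set (Fin d → ℤ))
    -- `Q` is even-nondegenerate of degree `p₁`
    (hEven : ∀ a : (Fin d → ℕ) → ℝ,
      (∀ ξ ∈ Q, ∑ α ∈ (multiIdx d p₁).filter (fun α => Even (∑ m, α m)),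
        a α * ∏ m, (ξ m : ℝ) ^ α m = 0) →
      ∀ α : Fin d → ℕ, (∑ m, α m) ≤ p₁ → Even (∑ m, α m) → a α = 0)
    -- `Q` is odd-nondegenerate of degree `p₁`
    (hOdd : ∀ a : (Fin d → ℕ) → ℝ,
      (∀ ξ ∈ Q, ∑ α ∈ (multiIdx d p₁).filter (fun α => Odd (∑ m, α m)),
        a α * ∏ m, (ξ m : ℝ) ^ α m = 0) →
      ∀ α : Fin d → ℕ, (∑ m, α m) ≤ p₁ → Odd (∑ m, α m) → a α = 0)
    (a a' : (Fin d → ℕ) → ℝ)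
    (δ : ℝ) (hδ : 0 < δ)
    -- the exponentials of the two symbols agree on `Q` for all small `t > 0`
    (h : ∀ ξ ∈ Q, ∀ t ∈ Set.Ioo (0 : ℝ) δ,
      Complex.exp ((∑ α ∈ multiIdx d p₁,
        (a α : ℂ) * (Complex.I ^ (∑ m, α m) * ∏ m, (ξ m : ℂ) ^ α m)) * t) =
      Complex.exp ((∑ α ∈ multiIdx d p₁,
        (a' α : ℂ) * (Complex.I ^ (∑ m, α m) * ∏ m, (ξ m : ℂ) ^ α m)) * t)) :
    ∀ α : Fin d → ℕ, (∑ m, α m) ≤ p₁ → a α = a' α := by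
  set c : (Fin d → ℕ) → ℝ := fun α => (-1) ^ ((∑ m, α m) / 2) * (a α - a' α) with hc
  have hsum : ∀ ξ ∈ Q, ∑ α ∈ multiIdx d p₁, Complex.I ^ (∑ m, α m) *
      (((a α - a' α) * ∏ m, (ξ m : ℝ) ^ α m : ℝ) : ℂ) = 0 := by
    intro ξ hξ
    rw [← sub_eq_zero.mpr (Complex.eq_of_exp_mul_eq_on_Ioo hδ (h ξ hξ)), ← sum_sub_distrib]
    refine sum_congr rfl fun α _ => ?_
    push_cast
    ring
  have hcancel : ∀ α, c α = 0 → a α = a' α := fun α hα =>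
    sub_eq_zero.mp ((mul_eq_zero.mp hα).resolve_left (pow_ne_zero _ (by norm_num)))
  intro α hα
  apply hcancel
  rcases Nat.even_or_odd (∑ m, α m) with hpar | hpar
  · refine hEven c (fun ξ hξ => ?_) α hα hpar
    have hre := congrArg Complex.re (hsum ξ hξ)
    rw [Complex.re_sum, Complex.zero_re] at hre
    rw [← hre, sum_filter]
    refine sum_congr rfl fun β _ => ?_
    rw [Complex.re_mul_ofReal, Complex.I_pow_re, hc]
    split_ifs <;> ring
  · refine hOdd c (fun ξ hξ => ?_) α hα hpar
    have him := congrArg Complex.im (hsum ξ hξ)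
    rw [Complex.im_sum, Complex.zero_im] at him
    rw [← him, sum_filter]
    refine sum_congr rfl fun β _ => ?_
    rw [Complex.im_mul_ofReal, Complex.I_pow_im, hc]
    split_ifs <;> ring
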